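/- arXiv:1012.3763 — 2 statements merged into one kernel-verified Lean document; each statement's English description precedes it below -/
import Mathlib

section
/- Let B, C, A', B', C' be finite-dimensional vector spaces over a field K and let β : B → C, δ : C → A', α' : A' → B', β' : B' → C' be linear maps with range β = ker δ, range δ = ker α', and range α' = ker β' (exactness at C, A' and B'). Then finrank B + finrank A' = finrank (ker β) + finrank (ker β') + finrank C. -/
open Module

/-- For an exact segment `B →β C →δ A' →α' B' →β' C'` of finite-dimensional
vector spaces, `finrank B + finrank A' = finrank (ker β) + finrank (ker β') + finrank C`. -/
theorem finrank_ker_beta_formula_of_exact_segment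
    {K B C A' B' C' : Type*} [Field K]
    [AddCommGroup B] [Module K B] [FiniteDimensional K B]
    [AddCommGroup C] [Module K C] [FiniteDimensional K C]
    [AddCommGroup A'] [Module K A'] [FiniteDimensional K A']
    [AddCommGroup B'] [Module K B'] [FiniteDimensional K B']
    [AddCommGroup C'] [Module K C'] [FiniteDimensional K C']
    (β : B →ₗ[K] C) (δ : C →ₗ[K] A') (α' : A' →ₗ[K] B') (β' : B' →ₗ[K] C')
    (hβδ : LinearMap.range β = LinearMap.ker δ)
    (hδα' : LinearMap.range δ = LinearMap.ker α')
    (hα'β' : LinearMap.range α' = LinearMap.ker β') :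
    finrank K B + finrank K A' =
      finrank K (LinearMap.ker β) + finrank K (LinearMap.ker β') + finrank K C := by
  have h1 := LinearMap.finrank_range_add_finrank_ker β
  have h2 := LinearMap.finrank_range_add_finrank_ker δ
  have h3 := LinearMap.finrank_range_add_finrank_ker α'
  rw [hβδ] at h1
  rw [hδα'] at h2
  rw [hα'β'] at h3
  omega
end

section
/- Consider a finite exact sequence of finite-dimensional vector spaces over a field K of the form 0 → A_N →^{α_N} B_N →^{β_N} C_N →^{δ_N} A_{N-1} → ⋯ → A_0 →^{α_0} B_0 →^{β_0} C_0 → 0, i.e., α_N is injective, range α_n = ker β_n for all 0 ≤ n ≤ N, range β_n = ker δ_n for all 1 ≤ n ≤ N, range δ_n = ker α_{n-1} for all 1 ≤ n ≤ N, and β_0 is surjective. Then for every 0 ≤ n ≤ N, as integers, finrank (ker α_n) = Σ_{m=n+1}^{N} (-1)^{m-n-1} (finrank A_m + finrank C_m − finrank B_m). -/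
open Module

/-- In a finite exact sequence
`0 → A_N → B_N → C_N → A_{N-1} → ⋯ → A_0 → B_0 → C_0 → 0`
of finite-dimensional vector spaces (here `δ n : C (n+1) → A n` plays the role
of the connecting map `δ_{n+1}` of the paper), for every `n ≤ N`,
`finrank (ker α_n) = Σ_{m=n+1}^{N} (-1)^{m-n-1} (finrank A_m + finrank C_m − finrank B_m)`. -/
theorem finrank_ker_alpha_of_exact_sequence
    {K : Type*} [Field K] (N : ℕ) (A B C : ℕ → Type*)
    [∀ n, AddCommGroup (A n)] [∀ n, Module K (A n)] [∀ n, FiniteDimensional K (A n)]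
    [∀ n, AddCommGroup (B n)] [∀ n, Module K (B n)] [∀ n, FiniteDimensional K (B n)]
    [∀ n, AddCommGroup (C n)] [∀ n, Module K (C n)] [∀ n, FiniteDimensional K (C n)]
    (α : ∀ n, A n →ₗ[K] B n) (β : ∀ n, B n →ₗ[K] C n) (δ : ∀ n, C (n + 1) →ₗ[K] A n)
    (hinj : Function.Injective (α N))
    (hαβ : ∀ n ≤ N, LinearMap.range (α n) = LinearMap.ker (β n))
    (hβδ : ∀ n < N, LinearMap.range (β (n + 1)) = LinearMap.ker (δ n))
    (hδα : ∀ n < N, LinearMap.range (δ n) = LinearMap.ker (α n))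
    (hsurj : Function.Surjective (β 0)) :
    ∀ n ≤ N, (finrank K (LinearMap.ker (α n)) : ℤ) =
      ∑ m ∈ Finset.Icc (n + 1) N,
        (-1 : ℤ) ^ (m - n - 1) *
          ((finrank K (A m) : ℤ) + (finrank K (C m) : ℤ) - (finrank K (B m) : ℤ)) := by
  intro n hn
  induction hn using Nat.decreasingInduction with
  | self =>
    rw [LinearMap.ker_eq_bot.mpr hinj]
    simp
  | of_succ n hn ih =>
    have hstep : (finrank K (LinearMap.ker (α n)) : ℤ) =
        ((finrank K (A (n + 1)) : ℤ) + (finrank K (C (n + 1)) : ℤ)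
          - (finrank K (B (n + 1)) : ℤ)) - finrank K (LinearMap.ker (α (n + 1))) := by
      have h1 := LinearMap.finrank_range_add_finrank_ker (δ n)
      have h2 := LinearMap.finrank_range_add_finrank_ker (β (n + 1))
      have h3 := LinearMap.finrank_range_add_finrank_ker (α (n + 1))
      rw [hδα n hn, ← hβδ n hn] at h1
      rw [← hαβ (n + 1) hn] at h2
      omega
    rw [hstep, ih, ← Finset.insert_Icc_add_one_left_eq_Icc (show n + 1 ≤ N from hn),
      Finset.sum_insert (by simp), sub_eq_add_neg, ← Finset.sum_neg_distrib]
    congr 1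
    · simp
    · refine Finset.sum_congr rfl fun m hm => ?_
      have hm' := (Finset.mem_Icc.mp hm).1
      have he : m - n - 1 = (m - (n + 1) - 1) + 1 := by omega
      rw [he, pow_succ]
      ring
end
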